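/- arXiv:1111.5538 — 4 statements merged into one kernel-verified Lean document; each statement's English description precedes it below -/
import Mathlib

section
/- Let μ be a cylindrical probability measure on a real Banach space U. Then μ is infinitely divisible if and only if μ is weakly infinitely divisible, i.e., if and only if the image measure μ∘π_{a₁,…,aₙ}⁻¹ on ℝⁿ is infinitely divisible for all a₁,…,aₙ ∈ U* and n ∈ ℕ. -/
open MeasureTheory Filter Topology Complex
open scoped ComplexOrder

noncomputable section

/-- The projection `π_{a₁,…,aₙ} : U → ℝⁿ`, `u ↦ (⟨u,a₁⟩,…,⟨u,aₙ⟩)`. -/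
def cylProj {U : Type*} [NormedAddCommGroup U] [NormedSpace ℝ U] {n : ℕ}
    (a : Fin n → (U →L[ℝ] ℝ)) : U → (Fin n → ℝ) :=
  fun u i => a i u

/-- A cylindrical measure on a Banach space `U`, identified with the consistent family of its
finite-dimensional images: measures `ν ∘ π_{a₁,…,aₙ}⁻¹` on `ℝⁿ`, with the consistency condition
that if `T : ℝⁿ → ℝᵐ` is linear and `bⱼ = Σᵢ Tⱼᵢ aᵢ`, then
`ν ∘ π_{b₁,…,bₘ}⁻¹ = (ν ∘ π_{a₁,…,aₙ}⁻¹) ∘ T⁻¹`. -/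
structure CylMeasure (U : Type*) [NormedAddCommGroup U] [NormedSpace ℝ U] where
  fd : ∀ n : ℕ, (Fin n → (U →L[ℝ] ℝ)) → Measure (Fin n → ℝ)
  consistent : ∀ (n m : ℕ) (a : Fin n → (U →L[ℝ] ℝ)) (T : (Fin n → ℝ) →ₗ[ℝ] (Fin m → ℝ)),
    fd m (fun j => ∑ i, T (Pi.single i 1) j • a i) = (fd n a).map T

/-- The one-dimensional image measure `ν ∘ a⁻¹` on `ℝ` of a cylindrical measure. -/
def CylMeasure.oneDim {U : Type*} [NormedAddCommGroup U] [NormedSpace ℝ U]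
    (ν : CylMeasure U) (a : U →L[ℝ] ℝ) : Measure ℝ :=
  (ν.fd 1 (fun _ => a)).map (fun x => x 0)

/-- A cylindrical probability measure: all finite-dimensional distributions are
probability measures. -/
structure CylProbMeasure (U : Type*) [NormedAddCommGroup U] [NormedSpace ℝ U]
    extends CylMeasure U where
  prob : ∀ (n : ℕ) (a : Fin n → (U →L[ℝ] ℝ)), IsProbabilityMeasure (fd n a)

def CylProbMeasure.oneDim {U : Type*} [NormedAddCommGroup U] [NormedSpace ℝ U]
    (μ : CylProbMeasure U) (a : U →L[ℝ] ℝ) : Measure ℝ :=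
  μ.toCylMeasure.oneDim a

/-- The characteristic function `φ_μ(a) = ∫ e^{is} (μ∘a⁻¹)(ds)` of a cylindrical
probability measure. -/
def CylProbMeasure.char {U : Type*} [NormedAddCommGroup U] [NormedSpace ℝ U]
    (μ : CylProbMeasure U) (a : U →L[ℝ] ℝ) : ℂ :=
  ∫ s, Complex.exp (Complex.I * (s : ℂ)) ∂(μ.oneDim a)

/-- Convolution of two measures on an additive group: image of the product measure
under addition. -/
def mconv {G : Type*} [MeasurableSpace G] [Add G] (ρ σ : Measure G) : Measure G :=
  (ρ.prod σ).map (fun p => p.1 + p.2)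

/-- `convPow ρ k` is the `k`-fold convolution `ρ^{∗k}`. -/
def convPow {G : Type*} [MeasurableSpace G] [Add G] [Zero G] (ρ : Measure G) : ℕ → Measure G
  | 0 => Measure.dirac 0
  | k + 1 => mconv (convPow ρ k) ρ

/-- A probability measure `ρ` is infinitely divisible if for every `k ≥ 1` there is a
probability measure `σ` with `ρ = σ^{∗k}`. -/
def IsInfDivisible {G : Type*} [MeasurableSpace G] [Add G] [Zero G] (ρ : Measure G) : Prop :=
  ∀ k : ℕ, 0 < k → ∃ σ : Measure G, IsProbabilityMeasure σ ∧ ρ = convPow σ k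

/-- A cylindrical probability measure `μ` is infinitely divisible if for every `k ≥ 1` there is a
cylindrical probability measure `ρ` with `φ_μ = (φ_ρ)^k`. -/
def CylProbMeasure.InfDivisible {U : Type*} [NormedAddCommGroup U] [NormedSpace ℝ U]
    (μ : CylProbMeasure U) : Prop :=
  ∀ k : ℕ, 0 < k → ∃ ρ : CylProbMeasure U, ∀ a, μ.char a = (ρ.char a) ^ k

/-- A cylindrical probability measure `μ` is weakly infinitely divisible if all its
finite-dimensional distributions `μ ∘ π_{a₁,…,aₙ}⁻¹` are infinitely divisible. -/
def CylProbMeasure.WeaklyInfDivisible {U : Type*} [NormedAddCommGroup U] [NormedSpace ℝ U]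
    (μ : CylProbMeasure U) : Prop :=
  ∀ (n : ℕ) (a : Fin n → (U →L[ℝ] ℝ)), IsInfDivisible (μ.fd n a)

/-- A truncation function: bounded, measurable and equal to the identity near `0`. -/
def IsTruncFun (h : ℝ → ℝ) : Prop :=
  Measurable h ∧ (∃ C : ℝ, ∀ s, |h s| ≤ C) ∧ (∃ ε > (0 : ℝ), ∀ s : ℝ, |s| < ε → h s = s)

/-- The kernel `ψ_h(t) = e^{it} − 1 − i·h(t)`. -/
def psiKer (h : ℝ → ℝ) (t : ℝ) : ℂ :=
  Complex.exp (Complex.I * (t : ℂ)) - 1 - Complex.I * (h t : ℂ)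

/-- A Lévy measure on `ℝ`: σ-finite, no mass at `0`, and `∫ (|s|² ∧ 1) dη < ∞`. -/
def IsLevyMeasure1 (η : Measure ℝ) : Prop :=
  SigmaFinite η ∧ η {0} = 0 ∧ (∫⁻ s, ENNReal.ofReal (min (s ^ 2) 1) ∂η) < ⊤

/-- A cylindrical Lévy measure: a cylindrical measure whose finite-dimensional images are
σ-finite and whose one-dimensional images are Lévy measures on `ℝ`. -/
def CylMeasure.IsCylLevy {U : Type*} [NormedAddCommGroup U] [NormedSpace ℝ U]
    (ν : CylMeasure U) : Prop :=
  (∀ (n : ℕ) (a : Fin n → (U →L[ℝ] ℝ)), SigmaFinite (ν.fd n a)) ∧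
  ∀ a : U →L[ℝ] ℝ, IsLevyMeasure1 (ν.oneDim a)

/-- `μ` has cylindrical characteristics `(p,q,ν)_h`:
`φ_μ(a) = exp( i p(a) − q(a)/2 + ∫ ψ_h(s) (ν∘a⁻¹)(ds) )` with `ν` a cylindrical Lévy measure. -/
def CylProbMeasure.HasCylChar {U : Type*} [NormedAddCommGroup U] [NormedSpace ℝ U]
    (μ : CylProbMeasure U) (p q : (U →L[ℝ] ℝ) → ℝ) (ν : CylMeasure U) (h : ℝ → ℝ) : Prop :=
  ν.IsCylLevy ∧
  ∀ a, μ.char a =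
    Complex.exp (Complex.I * (p a : ℂ) - (q a : ℂ) / 2 + ∫ s, psiKer h s ∂(ν.oneDim a))

/-- A quadratic form: `q(a) = β(a,a)` for a symmetric bilinear form `β`. -/
def IsQuadraticForm {E : Type*} [AddCommGroup E] [Module ℝ E] (q : E → ℝ) : Prop :=
  ∃ β : E →ₗ[ℝ] E →ₗ[ℝ] ℝ, (∀ a b, β a b = β b a) ∧ ∀ a, q a = β a a

/-- A negative-definite function on a real vector space (complex order is used for the
real inequalities). -/
def IsNegDefinite {E : Type*} [AddCommGroup E] (κ : E → ℂ) : Prop :=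
  0 ≤ κ 0 ∧ (∀ a, κ (-a) = starRingEnd ℂ (κ a)) ∧
  ∀ (n : ℕ) (a : Fin n → E) (z : Fin n → ℂ), (∑ i, z i) = 0 →
    (∑ i, ∑ j, z i * starRingEnd ℂ (z j) * κ (a i - a j)) ≤ 0

/-- A positive-definite function on a real vector space. -/
def IsPosDefinite {E : Type*} [AddCommGroup E] (φ : E → ℂ) : Prop :=
  ∀ (n : ℕ) (a : Fin n → E) (z : Fin n → ℂ),
    0 ≤ ∑ i, ∑ j, z i * starRingEnd ℂ (z j) * φ (a i - a j)

/-- `μ` is continuous with respect to a topology `t` on `U*`. -/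
def OCont {U : Type*} [NormedAddCommGroup U] [NormedSpace ℝ U]
    (t : TopologicalSpace (U →L[ℝ] ℝ)) (μ : CylProbMeasure U) : Prop :=
  ∀ ε : ℝ, 0 < ε → ∃ N ∈ @nhds _ t (0 : U →L[ℝ] ℝ), ∀ a ∈ N,
    μ.oneDim a {s : ℝ | 1 ≤ |s|} ≤ ENNReal.ofReal ε

lemma convPow_succ_eq_conv {G : Type*} [MeasurableSpace G] [AddMonoid G] (ρ : Measure G) (k : ℕ) :
    convPow ρ (k + 1) = (convPow ρ k).conv ρ := rfl

lemma isProbabilityMeasure_convPow {G : Type*} [MeasurableSpace G] [AddMonoid G]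
    [MeasurableAdd₂ G] (ρ : Measure G) [IsProbabilityMeasure ρ] (k : ℕ) :
    IsProbabilityMeasure (convPow ρ k) := by
  induction k with
  | zero => exact Measure.dirac.isProbabilityMeasure
  | succ k ih =>
    rw [convPow_succ_eq_conv]
    infer_instance

section CharFun

variable {E : Type*} [NormedAddCommGroup E] [NormedSpace ℝ E] [MeasurableSpace E] [BorelSpace E]
  [SecondCountableTopology E]

lemma charFunDual_convPow (ρ : Measure E) [IsProbabilityMeasure ρ] (k : ℕ) (L : StrongDual ℝ E) :
    charFunDual (convPow ρ k) L = charFunDual ρ L ^ k := by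
  induction k with
  | zero => simp [convPow, charFunDual_dirac]
  | succ k ih =>
    have := isProbabilityMeasure_convPow ρ k
    rw [convPow_succ_eq_conv, charFunDual_conv, ih, pow_succ]

lemma eq_convPow_iff_charFunDual [CompleteSpace E] {ρ σ : Measure E} [IsProbabilityMeasure ρ]
    [IsProbabilityMeasure σ] {k : ℕ} :
    ρ = convPow σ k ↔ ∀ L, charFunDual ρ L = charFunDual σ L ^ k := by
  have := isProbabilityMeasure_convPow σ k
  refine ⟨fun h L => by rw [h, charFunDual_convPow], fun h => ?_⟩
  exact Measure.ext_of_charFunDual (funext fun L => by rw [h, charFunDual_convPow])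

lemma one_sub_re_charFun_two_mul_le (ρ : Measure ℝ) [IsProbabilityMeasure ρ] (t : ℝ) :
    1 - (charFun ρ (2 * t)).re ≤ 4 * (1 - (charFun ρ t).re) := by
  have hcos (s : ℝ) : Integrable (fun x => Real.cos (s * x)) ρ :=
    Integrable.of_bound (by fun_prop) 1 (ae_of_all _ fun x => by simpa using Real.abs_cos_le_one _)
  have hre (s : ℝ) : (charFun ρ s).re = ∫ x, Real.cos (s * x) ∂ρ := by
    have hint : Integrable (fun x : ℝ => cexp (s * x * I)) ρ :=
      Integrable.of_bound (by fun_prop) 1 (ae_of_all _ fun x => by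
        rw [← ofReal_mul, norm_exp_ofReal_mul_I])
    rw [charFun_apply_real]
    refine (reCLM.integral_comp_comm hint).symm.trans (integral_congr_ae (ae_of_all _ fun x => ?_))
    simp only [reCLM_apply, ← ofReal_mul, exp_ofReal_mul_I_re]
  have hone (s : ℝ) : 1 - (charFun ρ s).re = ∫ x, (1 - Real.cos (s * x)) ∂ρ := by
    rw [integral_sub (integrable_const _) (hcos s), hre]
    simp
  rw [hone, hone, ← integral_const_mul]
  refine integral_mono ((integrable_const _).sub (hcos _))
    (((integrable_const _).sub (hcos _)).const_mul _) fun x => ?_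
  simp only [mul_assoc, Real.cos_two_mul]
  nlinarith [sq_nonneg (1 - Real.cos (t * x))]

lemma one_sub_norm_sq_charFun_two_mul_le (ρ : Measure ℝ) [IsProbabilityMeasure ρ] (t : ℝ) :
    1 - ‖charFun ρ (2 * t)‖ ^ 2 ≤ 4 * (1 - ‖charFun ρ t‖ ^ 2) := by
  have : IsProbabilityMeasure (ρ.map (fun x => (-1) * x)) :=
    Measure.isProbabilityMeasure_map (by fun_prop)
  have hsymm (s : ℝ) : (charFun (ρ.conv (ρ.map (fun x => (-1) * x))) s).re
      = ‖charFun ρ s‖ ^ 2 := by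
    rw [charFun_conv, charFun_map_mul, neg_one_mul, charFun_neg, mul_conj, ofReal_re,
      normSq_eq_norm_sq]
  simpa only [hsymm] using
    one_sub_re_charFun_two_mul_le (ρ.conv (ρ.map (fun x => (-1) * x))) t

/-- If every positive integer `k` admits a characteristic function which is a `k`-th root of
`charFun ρ`, then `charFun ρ` has no zeros. -/
lemma charFun_ne_zero_of_forall_exists_pow {ρ : Measure ℝ} [IsProbabilityMeasure ρ]
    (h : ∀ k : ℕ, 0 < k → ∃ σ : Measure ℝ, IsProbabilityMeasure σ ∧
      ∀ t, charFun ρ t = charFun σ t ^ k) (t : ℝ) :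
    charFun ρ t ≠ 0 := by
  have hdouble (s : ℝ) (hs : charFun ρ s ≠ 0) : charFun ρ (2 * s) ≠ 0 := by
    intro h0
    obtain ⟨k, hk⟩ := exists_pow_lt_of_lt_one (pow_pos (norm_pos_iff.2 hs) 2)
      (by norm_num : (3 / 4 : ℝ) < 1)
    rcases Nat.eq_zero_or_pos k with rfl | hkpos
    · have := pow_le_one₀ (n := 2) (norm_nonneg _) (norm_charFun_le_one (μ := ρ) s)
      rw [pow_zero] at hk
      linarith
    obtain ⟨σ, hσ, hpow⟩ := h k hkpos
    have hσ0 : charFun σ (2 * s) = 0 := eq_zero_of_pow_eq_zero (hpow (2 * s) ▸ h0)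
    have hle := one_sub_norm_sq_charFun_two_mul_le σ s
    rw [hσ0] at hle
    have hle' : ‖charFun σ s‖ ^ 2 ≤ 3 / 4 := by
      norm_num at hle
      linarith
    have := pow_le_pow_left₀ (sq_nonneg _) hle' k
    rw [hpow s, norm_pow, pow_right_comm] at hk
    linarith
  have hpow2 (m : ℕ) : charFun ρ (t / 2 ^ m) ≠ 0 → charFun ρ t ≠ 0 := by
    induction m with
    | zero => simp
    | succ m ih =>
      intro hm
      refine ih ?_
      convert hdouble _ hm using 2
      rw [pow_succ]
      field_simp
  have hlim : Tendsto (fun m : ℕ => t / 2 ^ m) atTop (𝓝 0) := by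
    simpa [div_eq_mul_inv] using
      (tendsto_pow_atTop_nhds_zero_of_lt_one (r := (2⁻¹ : ℝ)) (by norm_num)
        (by norm_num)).const_mul t
  have hev : ∀ᶠ s in 𝓝 (0 : ℝ), charFun ρ s ≠ 0 :=
    (continuous_charFun (μ := ρ)).continuousAt.eventually_ne (by simp)
  obtain ⟨m, hm⟩ := (hlim.eventually hev).exists
  exact hpow2 m hm

/-- Continuous `k`-th roots of a nowhere vanishing function on a connected space agree as soon as
they agree at one point. -/
lemma eq_of_pow_eq_pow_of_continuous {X : Type*} [TopologicalSpace X] [PreconnectedSpace X]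
    {f g : X → ℂ} (hf : Continuous f) (hg : Continuous g) (hg0 : ∀ x, g x ≠ 0) {k : ℕ}
    (hk : 0 < k) (h : ∀ x, f x ^ k = g x ^ k) {x₀ : X} (h₀ : f x₀ = g x₀) : f = g := by
  have hfin : {z : ℂ | z ^ k = 1}.Finite := by
    refine (Polynomial.nthRoots k (1 : ℂ)).toFinset.finite_toSet.subset fun z hz => ?_
    simpa [Polynomial.mem_nthRoots hk] using hz
  have hconn : IsPreconnected (Set.range fun x => f x / g x) :=
    isPreconnected_range (hf.div hg hg0)
  have hsub : Set.range (fun x => f x / g x) ⊆ {z : ℂ | z ^ k = 1} := by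
    rintro _ ⟨x, rfl⟩
    simp [div_pow, h x, hg0 x]
  have hss := hfin.countable.isTotallyDisconnected _ hsub hconn
  funext x
  have hx : f x / g x = f x₀ / g x₀ := hss ⟨x, rfl⟩ ⟨x₀, rfl⟩
  rw [h₀, div_self (hg0 x₀)] at hx
  exact (div_eq_one_iff_eq (hg0 x)).1 hx

/-- Convolution roots of an infinitely divisible probability measure are unique. -/
lemma IsInfDivisible.eq_of_eq_convPow [CompleteSpace E] {ρ : Measure E} [IsProbabilityMeasure ρ]
    (hρ : IsInfDivisible ρ) {σ τ : Measure E} [IsProbabilityMeasure σ] [IsProbabilityMeasure τ]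
    {k : ℕ} (hk : 0 < k) (hσ : ρ = convPow σ k) (hτ : ρ = convPow τ k) : σ = τ := by
  refine Measure.ext_of_charFunDual (funext fun L => ?_)
  have hprob (κ : Measure E) [IsProbabilityMeasure κ] : IsProbabilityMeasure (κ.map L) :=
    Measure.isProbabilityMeasure_map (by fun_prop)
  have hpow {κ : Measure E} [IsProbabilityMeasure κ] {l : ℕ} (h : ρ = convPow κ l) (t : ℝ) :
      charFun (ρ.map L) t = charFun (κ.map L) t ^ l := by
    simp only [charFun_map_eq_charFunDual_smul]
    exact eq_convPow_iff_charFunDual.1 h _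
  have hρ0 := charFun_ne_zero_of_forall_exists_pow (ρ := ρ.map L) fun l hl => by
    obtain ⟨κ, hκ, h⟩ := hρ l hl
    exact ⟨κ.map L, hprob κ, hpow h⟩
  have hτ0 (t : ℝ) : charFun (τ.map L) t ≠ 0 := fun h0 =>
    hρ0 t (by rw [hpow hτ, h0, zero_pow hk.ne'])
  have := eq_of_pow_eq_pow_of_continuous (continuous_charFun (μ := σ.map L))
    (continuous_charFun (μ := τ.map L)) hτ0 hk
    (fun t => by rw [← hpow hσ, ← hpow hτ]) (x₀ := 0) (by simp)
  rw [charFunDual_eq_charFun_map_one, charFunDual_eq_charFun_map_one, this]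

lemma eq_convPow_map [CompleteSpace E] {F : Type*} [NormedAddCommGroup F] [NormedSpace ℝ F]
    [MeasurableSpace F] [BorelSpace F] [SecondCountableTopology F] [CompleteSpace F]
    {ρ σ : Measure E} [IsProbabilityMeasure ρ] [IsProbabilityMeasure σ] {k : ℕ}
    (h : ρ = convPow σ k) (T : E →L[ℝ] F) : ρ.map T = convPow (σ.map T) k := by
  have : IsProbabilityMeasure (ρ.map T) := Measure.isProbabilityMeasure_map (by fun_prop)
  have : IsProbabilityMeasure (σ.map T) := Measure.isProbabilityMeasure_map (by fun_prop)
  refine eq_convPow_iff_charFunDual.2 fun L => ?_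
  rw [charFunDual_map, charFunDual_map]
  exact eq_convPow_iff_charFunDual.1 h _

end CharFun

namespace CylProbMeasure

variable {U : Type*} [NormedAddCommGroup U] [NormedSpace ℝ U]

lemma char_eq_charFunDual (μ : CylProbMeasure U) (a : U →L[ℝ] ℝ) :
    μ.char a = charFunDual (μ.fd 1 fun _ => a) (ContinuousLinearMap.proj 0) := by
  rw [charFunDual_eq_charFun_map_one, charFun_apply_real]
  simp only [ofReal_one, one_mul, mul_comm _ I]
  rfl

lemma charFunDual_fd (μ : CylProbMeasure U) {n : ℕ} (a : Fin n → (U →L[ℝ] ℝ))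
    (L : StrongDual ℝ (Fin n → ℝ)) :
    charFunDual (μ.fd n a) L = μ.char (∑ i, L (Pi.single i 1) • a i) := by
  have h : μ.fd 1 (fun _ => ∑ i, L (Pi.single i 1) • a i) =
      (μ.fd n a).map (ContinuousLinearMap.pi fun _ : Fin 1 => L) :=
    μ.consistent n 1 a (ContinuousLinearMap.pi fun _ : Fin 1 => L).toLinearMap
  rw [char_eq_charFunDual, h, charFunDual_map]
  rfl

end CylProbMeasure

/-- A cylindrical probability measure is infinitely divisible if and only if it is
weakly infinitely divisible. -/
theorem infDivisible_iff_weaklyInfDivisible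
    {U : Type*} [NormedAddCommGroup U] [NormedSpace ℝ U]
    (μ : CylProbMeasure U) :
    μ.InfDivisible ↔ μ.WeaklyInfDivisible := by
  have hμ := μ.prob
  constructor
  · intro h n a k hk
    obtain ⟨ρ, hρ⟩ := h k hk
    have := ρ.prob n a
    refine ⟨ρ.fd n a, this, eq_convPow_iff_charFunDual.2 fun L => ?_⟩
    rw [μ.charFunDual_fd, ρ.charFunDual_fd, hρ]
  · intro h k hk
    choose σ hσ hroot using fun n a => h n a k hk
    refine ⟨⟨⟨σ, fun n m a T => ?_⟩, hσ⟩, fun a => ?_⟩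
    · have : IsProbabilityMeasure ((σ n a).map T) :=
        Measure.isProbabilityMeasure_map T.toContinuousLinearMap.measurable.aemeasurable
      refine (h m _).eq_of_eq_convPow hk (hroot m _) ?_
      rw [μ.consistent]
      exact eq_convPow_map (hroot n a) T.toContinuousLinearMap
    · rw [CylProbMeasure.char_eq_charFunDual, CylProbMeasure.char_eq_charFunDual]
      exact eq_convPow_iff_charFunDual.1 (hroot 1 _) _
end
end

section
/- Let μ be a Radon probability measure on the Borel σ-algebra of a real Banach space U. Then μ is infinitely divisible (for every k ∈ ℕ there exists a Radon probability measure μ_k on U with μ = μ_k^{∗k}, the k-fold convolution with respect to addition in U) if and only if the image measure μ∘π_{a₁,…,aₙ}⁻¹ on ℝⁿ is an infinitely divisible probability measure for all a₁,…,aₙ ∈ U* and all n ∈ ℕ. -/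
open MeasureTheory Filter Topology Complex
open scoped ComplexOrder

noncomputable section

section Convolution

variable {G H : Type*} [MeasurableSpace G] [MeasurableSpace H]

lemma isProbabilityMeasure_mconv [Add G] [MeasurableAdd₂ G] (ρ σ : Measure G)
    [IsProbabilityMeasure ρ] [IsProbabilityMeasure σ] : IsProbabilityMeasure (mconv ρ σ) :=
  Measure.isProbabilityMeasure_map measurable_add.aemeasurable

instance isProbabilityMeasure_convPow_s2 [Add G] [Zero G] [MeasurableAdd₂ G] (σ : Measure G)
    [IsProbabilityMeasure σ] (k : ℕ) : IsProbabilityMeasure (convPow σ k) := by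
  induction k with
  | zero => exact Measure.dirac.isProbabilityMeasure
  | succ k ih => exact isProbabilityMeasure_mconv _ _

/-- Additive maps commute with convolution powers, provided the addition of the target is
measurable along the images. -/
lemma convPow_map_of_aemeasurable [AddGroup G] [AddGroup H] [MeasurableAdd₂ G] {f : G →+ H}
    (hf : Measurable f)
    (hadd : ∀ ρ σ : Measure G, IsProbabilityMeasure ρ → IsProbabilityMeasure σ →
      AEMeasurable (fun p : H × H => p.1 + p.2) ((ρ.map f).prod (σ.map f)))
    (σ : Measure G) [IsProbabilityMeasure σ] (k : ℕ) :
    convPow (σ.map f) k = (convPow σ k).map f := by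
  induction k with
  | zero => simp [convPow, Measure.map_dirac' hf]
  | succ k ih =>
    have h := hadd (convPow σ k) σ inferInstance inferInstance
    rw [convPow, convPow, ih, mconv, mconv, Measure.map_map hf measurable_add]
    rw [Measure.map_prod_map _ _ hf hf] at h ⊢
    rw [AEMeasurable.map_map_of_aemeasurable h (hf.prodMap hf).aemeasurable]
    congr 1
    ext p
    simp

lemma convPow_map [AddGroup G] [AddGroup H] [MeasurableAdd₂ G] [MeasurableAdd₂ H] {f : G →+ H}
    (hf : Measurable f) (σ : Measure G) [IsProbabilityMeasure σ] (k : ℕ) :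
    convPow (σ.map f) k = (convPow σ k).map f :=
  convPow_map_of_aemeasurable hf (fun _ _ _ _ => measurable_add.aemeasurable) σ k

lemma convPow_map_of_measurableEmbedding [AddGroup G] [AddGroup H] [MeasurableAdd₂ G]
    {f : G →+ H} (hf : MeasurableEmbedding f) (σ : Measure G) [IsProbabilityMeasure σ] (k : ℕ) :
    convPow (σ.map f) k = (convPow σ k).map f := by
  refine convPow_map_of_aemeasurable hf.measurable (fun ρ τ _ _ => ?_) σ k
  rw [Measure.map_prod_map _ _ hf.measurable hf.measurable, (hf.prodMap hf).aemeasurable_map_iff]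
  have : (fun p : H × H => p.1 + p.2) ∘ Prod.map f f = fun p : G × G => f (p.1 + p.2) := by
    ext p
    simp
  rw [this]
  exact (hf.measurable.comp measurable_add).aemeasurable

/-- If a convolution power of `σ` is concentrated on a subspace, so is `σ`. -/
lemma ae_mem_of_ae_mem_convPow [AddCommGroup G] [Module ℝ G] [MeasurableAdd₂ G]
    (W : Submodule ℝ G) (hW : MeasurableSet (W : Set G)) (σ : Measure G) [IsProbabilityMeasure σ]
    {k : ℕ} (hk : 0 < k) (h : ∀ᵐ x ∂(convPow σ k), x ∈ W) : ∀ᵐ x ∂σ, x ∈ W := by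
  obtain ⟨x, hx⟩ : ∃ x, ∀ᵐ y ∂σ, x + y ∈ W := by
    obtain ⟨m, rfl⟩ := Nat.exists_eq_add_of_le' hk
    rw [convPow, mconv] at h
    have h' := ae_of_ae_map measurable_add.aemeasurable h
    exact (Measure.ae_ae_of_ae_prod h').exists
  have key : ∀ m : ℕ, ∀ᵐ z ∂(convPow σ m), (m : ℝ) • x + z ∈ W := by
    intro m
    have hmeas : ∀ m : ℕ, MeasurableSet {z | (m : ℝ) • x + z ∈ W} := fun m =>
      (measurable_const_add ((m : ℝ) • x)) hW
    induction m with
    | zero =>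
      have := ae_dirac_iff (a := (0 : G)) (hmeas 0)
      simpa [convPow] using this
    | succ m ih =>
      rw [convPow, mconv, ae_map_iff measurable_add.aemeasurable (hmeas _)]
      filter_upwards [Measure.quasiMeasurePreserving_fst.ae ih,
        Measure.quasiMeasurePreserving_snd.ae hx] with p h1 h2
      have := W.add_mem h1 h2
      convert this using 1
      push_cast
      module
  obtain ⟨z, hz1, hz2⟩ := ((key k).and h).exists
  have hkx : (k : ℝ) • x ∈ W := by simpa using W.sub_mem hz1 hz2
  have hx' : x ∈ W := by
    have hk' : (k : ℝ) ≠ 0 := by positivity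
    simpa [smul_smul, hk'] using W.smul_mem ((k : ℝ)⁻¹) hkx
  filter_upwards [hx] with y hy
  simpa using W.sub_mem hy hx'

lemma measure_pow_le_convPow [AddGroup G] [MeasurableAdd₂ G] (f : G →+ ℝ)
    (σ : Measure G) [IsProbabilityMeasure σ] (t : ℝ) (k : ℕ) :
    σ {x | t ≤ f x} ^ k ≤ convPow σ k {x | k * t ≤ f x} := by
  induction k with
  | zero => simp [convPow]
  | succ k ih =>
    calc σ {x | t ≤ f x} ^ (k + 1)
        ≤ convPow σ k {x | k * t ≤ f x} * σ {x | t ≤ f x} := by rw [pow_succ]; gcongr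
      _ = ((convPow σ k).prod σ) ({x | k * t ≤ f x} ×ˢ {x | t ≤ f x}) :=
          (Measure.prod_prod _ _).symm
      _ ≤ ((convPow σ k).prod σ) ((fun p => p.1 + p.2) ⁻¹' {x | (k + 1 : ℕ) * t ≤ f x}) := by
          refine measure_mono fun p hp => ?_
          simp only [Set.mem_prod, Set.mem_ofPred_eq, Set.mem_preimage, map_add] at hp ⊢
          push_cast
          linarith [hp.1, hp.2]
      _ ≤ _ := Measure.le_map_apply measurable_add.aemeasurable _

/-- Convolution powers as an operation on bundled probability measures. -/
def probConvPow [AddGroup G] [MeasurableAdd₂ G] (σ : ProbabilityMeasure G) (k : ℕ) :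
    ProbabilityMeasure G :=
  ⟨convPow (σ : Measure G) k, inferInstance⟩

lemma continuous_probConvPow [AddGroup G] [TopologicalSpace G] [BorelSpace G]
    [SecondCountableTopology G] [TopologicalSpace.PseudoMetrizableSpace G] [ContinuousAdd G]
    (k : ℕ) :
    Continuous fun σ : ProbabilityMeasure G => probConvPow σ k := by
  induction k with
  | zero => exact continuous_of_const fun _ _ => rfl
  | succ k ih =>
    have hpair : Continuous fun σ : ProbabilityMeasure G =>
        (probConvPow σ k, σ) :=
      ih.prodMk continuous_id
    have hadd : Continuous fun p : G × G => p.1 + p.2 := continuous_add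
    exact (ProbabilityMeasure.continuous_map hadd).comp
      (ProbabilityMeasure.continuous_prod.comp hpair)

end Convolution

section Sequences

/-- Extension of a finite sequence by zero. -/
def extendZero (n : ℕ) : (Fin n → ℝ) →+ (ℕ → ℝ) where
  toFun y j := if h : j < n then y ⟨j, h⟩ else 0
  map_zero' := by ext j; simp
  map_add' x y := by ext j; by_cases h : j < n <;> simp [h]

lemma measurable_extendZero (n : ℕ) : Measurable (extendZero n) := by
  refine measurable_pi_lambda _ fun j => ?_
  by_cases h : j < n
  · simpa [extendZero, h] using measurable_pi_apply _
  · simp [extendZero, h]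

/-- The first `n` terms of a sequence. -/
def firstTerms (n : ℕ) (x : ℕ → ℝ) : Fin n → ℝ := fun i => x i

lemma measurable_firstTerms (n : ℕ) : Measurable (firstTerms n) :=
  measurable_pi_lambda _ fun _ => measurable_pi_apply _

lemma extendZero_firstTerms (n : ℕ) (x : ℕ → ℝ) (j : ℕ) :
    extendZero n (firstTerms n x) j = if j < n then x j else 0 := by
  simp [extendZero, firstTerms]

lemma tendsto_map_extendZero_firstTerms (μ : ProbabilityMeasure (ℕ → ℝ)) :
    Tendsto (fun n => μ.map
      ((measurable_extendZero n).comp (measurable_firstTerms n)).aemeasurable) atTop (𝓝 μ) := by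
  rw [ProbabilityMeasure.tendsto_iff_forall_integral_tendsto]
  intro f
  have hm := fun n => (measurable_extendZero n).comp (measurable_firstTerms n)
  have hpt : ∀ x : ℕ → ℝ, Tendsto (fun n => extendZero n (firstTerms n x)) atTop (𝓝 x) := by
    intro x
    rw [tendsto_pi_nhds]
    intro j
    refine tendsto_const_nhds.congr' ?_
    filter_upwards [eventually_gt_atTop j] with n hn
    simp [extendZero_firstTerms, hn]
  have heq : ∀ n, ∫ x, f x ∂((μ.map (hm n).aemeasurable : ProbabilityMeasure (ℕ → ℝ)) :
      Measure (ℕ → ℝ)) = ∫ x, f (extendZero n (firstTerms n x)) ∂(μ : Measure (ℕ → ℝ)) := by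
    intro n
    rw [ProbabilityMeasure.toMeasure_map, integral_map (hm n).aemeasurable
      f.continuous.aestronglyMeasurable]
    rfl
  simp_rw [heq]
  refine tendsto_integral_of_dominated_convergence (fun _ => ‖f‖) (fun n => ?_)
    (integrable_const _) (fun n => ae_of_all _ fun x => f.norm_coe_le_norm _)
    (ae_of_all _ fun x => (f.continuous.tendsto _).comp (hpt x))
  exact (f.continuous.measurable.comp (hm n)).aestronglyMeasurable

/-- Tightness in a countable product follows from uniform tightness of the coordinates. -/
lemma isTightMeasureSet_of_coordinates {S : Set (Measure (ℕ → ℝ))}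
    (h : ∀ (i : ℕ) (δ : ENNReal), 0 < δ → ∃ t : ℝ, ∀ ν ∈ S, ν {x | t < |x i|} ≤ δ) :
    IsTightMeasureSet S := by
  rw [isTightMeasureSet_iff_exists_isCompact_measure_compl_le]
  intro ε hε
  obtain ⟨δ, hδ, hsum⟩ := ENNReal.exists_pos_sum_of_countable' hε.ne' ℕ
  choose t ht using fun i => h i (δ i) (hδ i)
  refine ⟨Set.univ.pi fun i => Set.Icc (-t i) (t i), isCompact_univ_pi fun i => isCompact_Icc,
    fun ν hν => ?_⟩
  calc ν (Set.univ.pi fun i => Set.Icc (-t i) (t i))ᶜ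
      ≤ ν (⋃ i, {x | t i < |x i|}) := by
        refine measure_mono fun x hx => ?_
        by_contra hcon
        refine hx fun i _ => ?_
        simp only [Set.mem_iUnion, Set.mem_ofPred_eq, not_exists, not_lt] at hcon
        exact abs_le.1 (hcon i)
    _ ≤ ∑' i, ν {x | t i < |x i|} := measure_iUnion_le _
    _ ≤ ∑' i, δ i := ENNReal.tsum_le_tsum fun i => ht i ν hν
    _ ≤ ε := hsum.le

lemma exists_measure_abs_ge_le (μ : Measure (ℕ → ℝ)) [IsProbabilityMeasure μ] (i : ℕ)
    {η : ENNReal} (hη : 0 < η) : ∃ t : ℝ, 0 < t ∧ μ {x | t ≤ |x i|} ≤ η := by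
  have hlim : Tendsto (fun m : ℕ => μ {x | (m : ℝ) ≤ |x i|}) atTop (𝓝 0) := by
    have hempty : ⋂ m : ℕ, {x : ℕ → ℝ | (m : ℝ) ≤ |x i|} = ∅ := by
      ext x
      obtain ⟨m, hm⟩ := exists_nat_gt |x i|
      simp only [Set.mem_iInter, Set.mem_ofPred_eq, Set.mem_empty_iff_false, iff_false, not_forall,
        not_le]
      exact ⟨m, hm⟩
    rw [← measure_empty (μ := μ), ← hempty]
    refine tendsto_measure_iInter_atTop (fun m => ?_) (fun m m' hmm x (hx : (m' : ℝ) ≤ |x i|) => ?_)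
      ⟨0, measure_ne_top _ _⟩
    · exact (measurableSet_le measurable_const (by fun_prop)).nullMeasurableSet
    · exact (Nat.cast_le.2 hmm).trans hx
  obtain ⟨m, hm, hm0⟩ := ((hlim.eventually (gt_mem_nhds hη)).and (eventually_gt_atTop 0)).exists
  exact ⟨m, Nat.cast_pos.2 hm0, hm.le⟩

/-- Coordinate tails of a convolution root are controlled by those of its power. -/
lemma measure_abs_gt_le_of_convPow {k : ℕ} (hk : 0 < k) (ν : Measure (ℕ → ℝ))
    [IsProbabilityMeasure ν] (i : ℕ) {δ : ENNReal} {t : ℝ}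
    (h : convPow ν k {x | t ≤ |x i|} ≤ (δ / 2) ^ k) : ν {x | t / k < |x i|} ≤ δ := by
  have hk' : (0 : ℝ) < k := Nat.cast_pos.2 hk
  have one_sided : ∀ f : (ℕ → ℝ) →+ ℝ, (∀ x, f x ≤ |x i|) → ν {x | t / k ≤ f x} ≤ δ / 2 := by
    intro f hf
    refine (ENNReal.pow_le_pow_left_iff hk.ne').1 ?_
    refine (measure_pow_le_convPow f ν (t / k) k).trans (le_trans (measure_mono fun x hx => ?_) h)
    rw [Set.mem_ofPred_eq, mul_div_cancel₀ _ hk'.ne'] at hx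
    exact hx.trans (hf x)
  have h1 := one_sided (Pi.evalAddMonoidHom (fun _ : ℕ => ℝ) i) fun x => le_abs_self _
  have h2 := one_sided (-Pi.evalAddMonoidHom (fun _ : ℕ => ℝ) i) fun x => neg_le_abs _
  calc ν {x | t / k < |x i|}
      ≤ ν ({x | t / k ≤ Pi.evalAddMonoidHom (fun _ : ℕ => ℝ) i x} ∪
          {x | t / k ≤ (-Pi.evalAddMonoidHom (fun _ : ℕ => ℝ) i) x}) := by
        refine measure_mono fun x (hx : t / k < |x i|) => ?_
        refine (lt_abs.1 hx).imp (fun h => ?_) fun h => ?_ <;> simpa using h.le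
    _ ≤ δ / 2 + δ / 2 := (measure_union_le _ _).trans (add_le_add h1 h2)
    _ = δ := ENNReal.add_halves δ

/-- A probability measure on `ℕ → ℝ` has a `k`-th convolution root as soon as its
finite-dimensional marginals do. -/
lemma exists_convPow_eq_of_firstTerms {k : ℕ} (hk : 0 < k) (μ : Measure (ℕ → ℝ))
    [IsProbabilityMeasure μ]
    (h : ∀ n, ∃ σ : Measure (Fin n → ℝ), IsProbabilityMeasure σ ∧
      μ.map (firstTerms n) = convPow σ k) :
    ∃ ν : Measure (ℕ → ℝ), IsProbabilityMeasure ν ∧ convPow ν k = μ := by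
  choose σ hσ hμσ using h
  have hν : ∀ n, IsProbabilityMeasure ((σ n).map (extendZero n)) := fun n =>
    Measure.isProbabilityMeasure_map (measurable_extendZero n).aemeasurable
  have hm := fun n => (measurable_extendZero n).comp (measurable_firstTerms n)
  have hconv : ∀ n, convPow ((σ n).map (extendZero n)) k =
      μ.map (extendZero n ∘ firstTerms n) := by
    intro n
    rw [convPow_map (measurable_extendZero n), ← hμσ,
      Measure.map_map (measurable_extendZero n) (measurable_firstTerms n)]
  let ν : ℕ → ProbabilityMeasure (ℕ → ℝ) := fun n => ⟨_, hν n⟩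
  have htight : IsTightMeasureSet {((ρ : ProbabilityMeasure (ℕ → ℝ)) : Measure (ℕ → ℝ)) |
      ρ ∈ Set.range ν} := by
    refine isTightMeasureSet_of_coordinates fun i δ hδ => ?_
    obtain ⟨t, ht0, ht⟩ := exists_measure_abs_ge_le μ i (η := (δ / 2) ^ k)
      (ENNReal.pow_pos (ENNReal.half_pos hδ.ne') k)
    refine ⟨t / k, ?_⟩
    rintro _ ⟨_, ⟨n, rfl⟩, rfl⟩
    refine measure_abs_gt_le_of_convPow hk (ν n : Measure (ℕ → ℝ)) i ?_
    change convPow ((σ n).map (extendZero n)) k _ ≤ _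
    rw [hconv, Measure.map_apply (hm n) (measurableSet_le measurable_const (by fun_prop))]
    refine le_trans (measure_mono fun x hx => ?_) ht
    simp only [Set.mem_preimage, Set.mem_ofPred_eq, Function.comp_apply,
      extendZero_firstTerms] at hx ⊢
    split_ifs at hx
    · exact hx
    · rw [abs_zero] at hx
      linarith
  have hcomp := isCompact_closure_of_isTightMeasureSet htight
  obtain ⟨ν₀, -, hν₀⟩ := hcomp.ultrafilter_le_nhds ((hyperfilter ℕ).map ν)
    (le_principal_iff.2 (mem_map.2 (Eventually.of_forall fun n => subset_closure ⟨n, rfl⟩)))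
  have hlim : Tendsto ν (hyperfilter ℕ) (𝓝 ν₀) := hν₀
  have hcont := continuous_probConvPow (G := ℕ → ℝ) k
  have hlim₁ := (hcont.tendsto ν₀).comp hlim
  let μ' : ProbabilityMeasure (ℕ → ℝ) := ⟨μ, inferInstance⟩
  have hlim₂ := (tendsto_map_extendZero_firstTerms μ').mono_left
    Nat.hyperfilter_le_atTop
  have heq : probConvPow ν₀ k = μ' :=
    tendsto_nhds_unique hlim₁ (hlim₂.congr fun n => Subtype.ext (hconv n).symm)
  exact ⟨ν₀, inferInstance, congrArg Subtype.val heq⟩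

end Sequences

section SigmaCompact

lemma IsSigmaCompact.measurableSet {X : Type*} [TopologicalSpace X] [T2Space X]
    [MeasurableSpace X] [OpensMeasurableSpace X] {s : Set X} (hs : IsSigmaCompact s) :
    MeasurableSet s := by
  obtain ⟨K, hK, rfl⟩ := hs
  exact MeasurableSet.iUnion fun n => (hK n).isClosed.measurableSet

lemma Continuous.measurableEmbedding_of_sigmaCompactSpace {X Y : Type*} [TopologicalSpace X]
    [SigmaCompactSpace X] [MeasurableSpace X] [BorelSpace X] [TopologicalSpace Y] [T2Space Y]
    [MeasurableSpace Y] [BorelSpace Y] {f : X → Y} (hf : Continuous f)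
    (hinj : Function.Injective f) : MeasurableEmbedding f := by
  refine ⟨hinj, hf.measurable, fun s hs => ?_⟩
  have hrange : MeasurableSet (Set.range f) := (isSigmaCompact_range hf).measurableSet
  have hclosed : ∀ s : Set X, IsClosed s → MeasurableSet (f '' s) := fun s hs =>
    ((isSigmaCompact_univ.of_isClosed_subset hs (Set.subset_univ s)).image hf).measurableSet
  rw [BorelSpace.measurable_eq (α := X), borel_eq_generateFrom_isClosed] at hs
  induction s, hs using MeasurableSpace.generateFrom_induction with
  | hC s hs _ => exact hclosed s hs
  | empty => simp
  | compl s _ ih => rw [Set.image_compl_eq_range_sdiff_image hinj]; exact hrange.diff ih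
  | iUnion s _ ih => rw [Set.image_iUnion]; exact MeasurableSet.iUnion ih

variable {U : Type*} [NormedAddCommGroup U] [NormedSpace ℝ U]

lemma isSigmaCompact_span {s : Set U} (hs : IsSigmaCompact s) :
    IsSigmaCompact (Submodule.span ℝ s : Set U) := by
  have := isSigmaCompact_iff_sigmaCompactSpace.1 hs
  have heq : (Submodule.span ℝ s : Set U) =
      ⋃ n : ℕ, Set.range fun f : Fin n → ℝ × s => ∑ i, (f i).1 • ((f i).2 : U) := by
    rw [Submodule.span_eq_iUnion_nat]
    refine Set.iUnion_congr fun n => ?_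
    ext x
    constructor
    · rintro ⟨f, hf, rfl⟩
      exact ⟨fun i => ((f i).1, ⟨(f i).2, hf i⟩), rfl⟩
    · rintro ⟨f, rfl⟩
      exact ⟨fun i => ((f i).1, ((f i).2 : U)), fun i => (f i).2.2, rfl⟩
  rw [heq]
  exact isSigmaCompact_iUnion _ fun n => isSigmaCompact_range (by fun_prop)

lemma exists_separating_seq (E : Submodule ℝ U) [TopologicalSpace.SeparableSpace E] :
    ∃ a : ℕ → (U →L[ℝ] ℝ), ∀ x ∈ E, (∀ i, a i x = 0) → x = 0 := by
  let d := TopologicalSpace.denseSeq E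
  choose a ha had using fun i => exists_dual_vector'' ℝ (d i : U)
  refine ⟨a, fun x hx h0 => ?_⟩
  rw [← norm_le_zero_iff]
  refine le_of_forall_pos_le_add fun ε hε => ?_
  obtain ⟨i, hi⟩ := (TopologicalSpace.denseRange_denseSeq E).exists_dist_lt ⟨x, hx⟩ (half_pos hε)
  have hdist : ‖(d i : U) - x‖ < ε / 2 := by
    rw [← dist_eq_norm, dist_comm]
    exact hi
  have h1 : ‖(d i : U)‖ ≤ ‖(d i : U) - x‖ := by
    have h2 : ‖(d i : U)‖ = a i ((d i : U) - x) := by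
      rw [map_sub, h0 i, sub_zero]
      simpa using (had i).symm
    rw [h2]
    exact (le_abs_self _).trans ((a i).le_of_opNorm_le (ha i) _ |>.trans_eq (one_mul _))
  have h3 : ‖x‖ ≤ ‖(d i : U)‖ + ‖(d i : U) - x‖ := norm_le_insert _ _
  linarith

variable [MeasurableSpace U] [BorelSpace U]

/-- A Radon probability measure is the image of a measure on a σ-compact subspace. -/
lemma exists_sigmaCompact_submodule (μ : Measure U) [IsProbabilityMeasure μ]
    [μ.InnerRegular] : ∃ (E : Submodule ℝ U) (μE : Measure E), SigmaCompactSpace E ∧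
      IsProbabilityMeasure μE ∧ μE.map E.subtype = μ := by
  have htight := isTightMeasureSet_iff_exists_isCompact_measure_compl_le.1
    (isTightMeasureSet_singleton_of_innerRegular (μ := μ))
  choose K hK hKμ using fun n : ℕ => htight ((n : ENNReal) + 1)⁻¹ (by simp)
  let E := Submodule.span ℝ (⋃ n, K n)
  have hE : IsSigmaCompact (E : Set U) :=
    isSigmaCompact_span (isSigmaCompact_iUnion_of_isCompact K hK)
  have hnull : μ (E : Set U)ᶜ = 0 := by
    refine le_antisymm (ENNReal.le_of_forall_pos_le_add fun ε hε _ => ?_) (by simp)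
    obtain ⟨n, hn⟩ := ENNReal.exists_inv_nat_lt (a := ε) (by simpa using hε.ne')
    rw [zero_add]
    calc μ (E : Set U)ᶜ ≤ μ (K n)ᶜ := measure_mono (Set.compl_subset_compl.2
          ((Set.subset_iUnion K n).trans Submodule.subset_span))
      _ ≤ ((n : ENNReal) + 1)⁻¹ := hKμ n μ rfl
      _ ≤ (n : ENNReal)⁻¹ := ENNReal.inv_le_inv.2 le_self_add
      _ ≤ ε := hn.le
  have hmap : (μ.comap (Subtype.val : E → U)).map Subtype.val = μ := by
    have hemb : MeasurableEmbedding (Subtype.val : E → U) :=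
      MeasurableEmbedding.subtype_coe hE.measurableSet
    rw [hemb.map_comap]
    refine Measure.restrict_eq_self_of_ae_mem (mem_ae_iff.2 ?_)
    convert hnull using 2
    ext
    simp
  refine ⟨E, μ.comap Subtype.val, isSigmaCompact_iff_sigmaCompactSpace.1 hE, ⟨?_⟩, hmap⟩
  rw [← Set.preimage_univ (f := (Subtype.val : E → U)),
    ← Measure.map_apply measurable_subtype_coe MeasurableSet.univ, hmap, measure_univ]

lemma measurable_cylProj {n : ℕ} (a : Fin n → (U →L[ℝ] ℝ)) : Measurable (cylProj a) :=
  measurable_pi_lambda _ fun i => (a i).measurable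

end SigmaCompact

/-- A Radon probability measure on a Banach space is infinitely divisible if and
only if all its finite-dimensional projections are infinitely divisible. -/
theorem radon_infDivisible_iff_finiteDim
    {U : Type*} [NormedAddCommGroup U] [NormedSpace ℝ U]
    [MeasurableSpace U] [BorelSpace U]
    (μ : Measure U) (hprob : IsProbabilityMeasure μ) (hRadon : μ.InnerRegular) :
    (∀ k : ℕ, 0 < k → ∃ μk : Measure U,
        IsProbabilityMeasure μk ∧ μk.InnerRegular ∧ μ = convPow μk k) ↔
    (∀ (n : ℕ) (a : Fin n → (U →L[ℝ] ℝ)), IsInfDivisible (μ.map (cylProj a))) := by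
  constructor
  · intro h n a k hk
    obtain ⟨ν, hν, hνR, rfl⟩ := h k hk
    obtain ⟨E, νE, hE, hνE, rfl⟩ := exists_sigmaCompact_submodule ν
    have : SecondCountableTopology E := EMetric.secondCountable_of_sigmaCompact E
    have hemb : MeasurableEmbedding E.subtype :=
      continuous_subtype_val.measurableEmbedding_of_sigmaCompactSpace Subtype.val_injective
    let f : E →+ (Fin n → ℝ) :=
      { toFun := fun x => cylProj a x
        map_zero' := by ext; simp [cylProj]
        map_add' := fun x y => by ext; simp [cylProj] }
    have hf : Measurable f := (measurable_cylProj a).comp measurable_subtype_coe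
    refine ⟨νE.map f, Measure.isProbabilityMeasure_map hf.aemeasurable, ?_⟩
    have h1 : convPow (νE.map E.subtype) k = (convPow νE k).map E.subtype :=
      convPow_map_of_measurableEmbedding (f := E.subtype.toAddMonoidHom) hemb νE k
    rw [convPow_map hf, h1, Measure.map_map (measurable_cylProj a) hemb.measurable]
    rfl
  · intro h k hk
    obtain ⟨E, μE, hE, hμE, rfl⟩ := exists_sigmaCompact_submodule μ
    have : SecondCountableTopology E := EMetric.secondCountable_of_sigmaCompact E
    have hemb : MeasurableEmbedding E.subtype :=
      continuous_subtype_val.measurableEmbedding_of_sigmaCompactSpace Subtype.val_injective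
    obtain ⟨a, ha⟩ := exists_separating_seq E
    let J : E →ₗ[ℝ] (ℕ → ℝ) := LinearMap.pi fun i => (a i : U →ₗ[ℝ] ℝ) ∘ₗ E.subtype
    have hJc : Continuous J := continuous_pi fun i => (a i).continuous.comp continuous_subtype_val
    have hJi : Function.Injective J := by
      rw [injective_iff_map_eq_zero]
      exact fun x hx => Subtype.ext (ha x x.2 fun i => congrFun hx i)
    have hJ : MeasurableEmbedding J := hJc.measurableEmbedding_of_sigmaCompactSpace hJi
    have : IsProbabilityMeasure (μE.map J) :=
      Measure.isProbabilityMeasure_map hJ.measurable.aemeasurable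
    obtain ⟨ν, hν, hνk⟩ := exists_convPow_eq_of_firstTerms hk (μE.map J) fun n => by
      obtain ⟨σ, hσ, hσk⟩ := h n (fun i => a i) k hk
      refine ⟨σ, hσ, ?_⟩
      rw [← hσk, Measure.map_map (measurable_firstTerms n) hJ.measurable, Measure.map_map
        (measurable_cylProj _) hemb.measurable]
      rfl
    have hrange : ∀ᵐ x ∂ν, x ∈ LinearMap.range J := by
      have hW : MeasurableSet (LinearMap.range J : Set (ℕ → ℝ)) := by
        rw [LinearMap.coe_range]
        exact hJ.measurableSet_range
      refine ae_mem_of_ae_mem_convPow _ hW ν hk ?_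
      rw [hνk]
      refine (ae_map_iff hJ.measurable.aemeasurable hW).2 ?_
      exact ae_of_all _ fun x => LinearMap.mem_range_self J x
    have hνmap : (ν.comap J).map J = ν := by
      rw [hJ.map_comap]
      exact Measure.restrict_eq_self_of_ae_mem hrange
    have : IsProbabilityMeasure (ν.comap J) := by
      refine ⟨?_⟩
      rw [← Set.preimage_univ (f := J), ← Measure.map_apply hJ.measurable MeasurableSet.univ,
        hνmap, measure_univ]
    have hroot : convPow (ν.comap J) k = μE := by
      have h1 : convPow ((ν.comap J).map J) k = (convPow (ν.comap J) k).map J :=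
        convPow_map (f := J.toAddMonoidHom) hJ.measurable _ k
      rw [hνmap, hνk] at h1
      rw [← hJ.comap_map μE, h1, hJ.comap_map]
    refine ⟨(ν.comap J).map E.subtype,
      Measure.isProbabilityMeasure_map hemb.measurable.aemeasurable,
      Measure.InnerRegular.map_of_continuous continuous_subtype_val, ?_⟩
    have h2 : convPow ((ν.comap J).map E.subtype) k = (convPow (ν.comap J) k).map E.subtype :=
      convPow_map_of_measurableEmbedding (f := E.subtype.toAddMonoidHom) hemb _ k
    rw [h2, hroot]
end
end

section
/- Let U be a real Banach space and q : U* → ℝ a quadratic form such that the function a ↦ exp(−½·q(a)) is positive-definite on U* and q is continuous with respect to the norm topology of U*. Then there exists a linear operator Q : U* → U** which is symmetric ( (Qa)(b) = (Qb)(a) for all a,b ∈ U* ) and positive ( (Qa)(a) ≥ 0 for all a ∈ U* ) such that q(a) = (Qa)(a) for all a ∈ U*. -/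
open MeasureTheory Filter Topology Complex
open scoped ComplexOrder

noncomputable section

/-- a norm-continuous quadratic form `q` on `U*` such that `a ↦ exp(−q(a)/2)` is
positive-definite is given by a symmetric positive linear operator `Q : U* → U**` via
`q(a) = (Qa)(a)`. -/
theorem quadraticForm_eq_operator
    {U : Type*} [NormedAddCommGroup U] [NormedSpace ℝ U]
    (q : (U →L[ℝ] ℝ) → ℝ) (hq : IsQuadraticForm q)
    (hpd : IsPosDefinite (fun a : U →L[ℝ] ℝ => Complex.exp (-(q a : ℂ) / 2)))
    (hcont : Continuous q) :
    ∃ Q : (U →L[ℝ] ℝ) →ₗ[ℝ] ((U →L[ℝ] ℝ) →L[ℝ] ℝ),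
      (∀ a b : U →L[ℝ] ℝ, Q a b = Q b a) ∧ (∀ a : U →L[ℝ] ℝ, 0 ≤ Q a a) ∧
      ∀ a : U →L[ℝ] ℝ, q a = Q a a := by
  obtain ⟨β, hsymm, hβ⟩ := hq
  have hpolar : ∀ a b, β a b = (q (a + b) - q a - q b) / 2 := by
    intro a b
    simp only [hβ, map_add, LinearMap.add_apply]
    rw [hsymm b a]
    ring
  have hβcont : ∀ a, Continuous (β a) := by
    intro a
    rw [show (β a : (U →L[ℝ] ℝ) → ℝ) = fun b => (q (a + b) - q a - q b) / 2 from
      funext (hpolar a)]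
    fun_prop
  have hnonneg : ∀ a, 0 ≤ q a := by
    intro a
    have hneg : q (-a) = q a := by simp [hβ]
    have hzero : q 0 = 0 := by simp [hβ]
    have h := hpd 2 ![a, 0] ![1, -1]
    have hcast : Complex.exp (-(q a : ℂ) / 2) = ((Real.exp (-q a / 2) : ℝ) : ℂ) := by
      push_cast
      rfl
    simp only [Fin.sum_univ_two, Matrix.cons_val_zero, Matrix.cons_val_one, sub_self, sub_zero,
      zero_sub, hneg, hzero, hcast, map_one, map_neg, Complex.ofReal_zero, neg_zero, zero_div,
      Complex.exp_zero] at h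
    have h' : 0 ≤ 2 - 2 * Real.exp (-q a / 2) := by
      rw [← Complex.zero_le_real]
      convert h using 1
      push_cast
      ring
    have hle : -q a / 2 ≤ 0 := Real.exp_le_one_iff.mp (by linarith)
    linarith
  refine ⟨{ toFun := fun a => ⟨β a, hβcont a⟩, map_add' := ?_, map_smul' := ?_ },
    hsymm, fun a => hβ a ▸ hnonneg a, hβ⟩
  · intro a b
    ext c
    simp
  · intro r a
    ext c
    simp
end
end

section
/- Let U be a real Banach space, ℓ : U* → ℝ a linear map (not assumed continuous) and λ > 0. Then there exists an infinitely divisible cylindrical probability measure μ on U whose characteristic function is φ_μ(a) = exp( λ·( e^{i·ℓ(a)} − 1 ) ) for all a ∈ U*. -/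
open MeasureTheory Filter Topology Complex
open scoped ComplexOrder

noncomputable section

open scoped NNReal

/-- The law of `k ↦ k • ℓ` under the Poisson distribution with rate `r`, as a cylindrical
probability measure. -/
def poissonCyl {U : Type*} [NormedAddCommGroup U] [NormedSpace ℝ U]
    (ℓ : (U →L[ℝ] ℝ) →ₗ[ℝ] ℝ) (r : ℝ≥0) : CylProbMeasure U where
  fd n a := (ProbabilityTheory.poissonMeasure r).map fun (k : ℕ) (i : Fin n) => (k : ℝ) * ℓ (a i)
  consistent n m a T := by
    rw [Measure.map_map T.continuous_of_finiteDimensional.measurable .of_discrete]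
    congr 1
    funext k j
    rw [Function.comp_apply, T.pi_apply_eq_sum_univ]
    simp only [map_sum, map_smul, smul_eq_mul, Finset.mul_sum, Finset.sum_apply, Pi.smul_apply]
    refine Finset.sum_congr rfl fun i _ => ?_
    have hsingle : (fun j => if i = j then (1 : ℝ) else 0) = Pi.single i 1 := by
      ext j
      simp [Pi.single_apply, eq_comm]
    rw [hsingle]
    ring
  prob _ _ := Measure.isProbabilityMeasure_map .of_discrete

theorem poissonCyl_oneDim {U : Type*} [NormedAddCommGroup U] [NormedSpace ℝ U]
    (ℓ : (U →L[ℝ] ℝ) →ₗ[ℝ] ℝ) (r : ℝ≥0) (a : U →L[ℝ] ℝ) :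
    (poissonCyl ℓ r).oneDim a =
      (ProbabilityTheory.poissonMeasure r).map fun k : ℕ => (k : ℝ) * ℓ a :=
  Measure.map_map (measurable_pi_apply 0) .of_discrete

theorem poissonCyl_char {U : Type*} [NormedAddCommGroup U] [NormedSpace ℝ U]
    (ℓ : (U →L[ℝ] ℝ) →ₗ[ℝ] ℝ) (r : ℝ≥0) (a : U →L[ℝ] ℝ) :
    (poissonCyl ℓ r).char a =
      Complex.exp ((r : ℂ) * (Complex.exp (Complex.I * (ℓ a : ℂ)) - 1)) := by
  have h := ProbabilityTheory.charFun_map_cast_poissonMeasure r (ℓ a)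
  rw [charFun_apply, integral_map .of_discrete (by fun_prop)] at h
  rw [CylProbMeasure.char, poissonCyl_oneDim, integral_map .of_discrete (by fun_prop),
    mul_comm I, ← h]
  simp [mul_comm]

/-- For a (not necessarily continuous) linear `ℓ : U* → ℝ` and `λ > 0` there is an
infinitely divisible cylindrical probability measure with characteristic function
`a ↦ exp(λ (e^{iℓ(a)} − 1))`. -/
theorem exists_infDivisible_poisson
    {U : Type*} [NormedAddCommGroup U] [NormedSpace ℝ U]
    (ℓ : (U →L[ℝ] ℝ) →ₗ[ℝ] ℝ) (lam : ℝ) (hlam : 0 < lam) :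
    ∃ μ : CylProbMeasure U, μ.InfDivisible ∧
      ∀ a : U →L[ℝ] ℝ,
        μ.char a = Complex.exp ((lam : ℂ) * (Complex.exp (Complex.I * (ℓ a : ℂ)) - 1)) := by
  lift lam to ℝ≥0 using hlam.le
  refine ⟨poissonCyl ℓ lam, fun k hk => ⟨poissonCyl ℓ (lam / k), fun a => ?_⟩,
    poissonCyl_char ℓ lam⟩
  have hk' : (k : ℂ) ≠ 0 := by exact_mod_cast hk.ne'
  rw [poissonCyl_char, poissonCyl_char, ← Complex.exp_nat_mul]
  push_cast
  congr 1
  field_simp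
end
end
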